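/- For all real numbers c₁, c₂, c₃, c₄, c₅, not all zero, the function h ↦ c₁ √(1+h) + c₂ (2+√(−h)) √(1−√(−h)) + c₃ h √(1−√(−h)) + c₄ (1+h) + c₅ Ī₂(h) has at most four zeros in the interval (−1,0). -/

import Mathlib

open intervalIntegral Real

/-- `Ī_k(h) = ∫_{u₁(h)}^{u₂(h)} u^k √(h + 2u² − u⁴) du` where
`u₁(h) = √(1 − √(1+h))` and `u₂(h) = √(1 + √(1+h))`. -/
noncomputable def Ibar (k : ℕ) (h : ℝ) : ℝ :=
  ∫ u in (Real.sqrt (1 - Real.sqrt (1 + h)))..(Real.sqrt (1 + Real.sqrt (1 + h))),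
    u ^ k * Real.sqrt (h + 2 * u ^ 2 - u ^ 4)

open Set Filter Topology MeasureTheory

/-- Differentiation under the integral sign over a compact interval, when the partial derivative
is jointly continuous. -/
theorem hasDerivAt_intervalIntegral_of_continuousOn {f f' : ℝ → ℝ → ℝ} {U : Set ℝ} {x₀ a b : ℝ}
    (hU : IsOpen U) (hx₀ : x₀ ∈ U) (hf : ∀ x ∈ U, Continuous (f x))
    (hf' : ContinuousOn (fun p : ℝ × ℝ => f' p.1 p.2) (U ×ˢ univ))
    (hd : ∀ x ∈ U, ∀ t, HasDerivAt (fun y => f y t) (f' x t) x) :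
    HasDerivAt (fun x => ∫ t in a..b, f x t) (∫ t in a..b, f' x₀ t) x₀ := by
  obtain ⟨ε, hε, hball⟩ := Metric.nhds_basis_closedBall.mem_iff.1 (hU.mem_nhds hx₀)
  obtain ⟨C, hC⟩ := ((isCompact_closedBall x₀ ε).prod
    (isCompact_uIcc (a := a) (b := b))).exists_bound_of_continuousOn
    (hf'.mono (prod_mono hball (subset_univ _)))
  have hcont : Continuous (f' x₀) := by
    rw [← continuousOn_univ]
    exact hf'.comp (f := fun t : ℝ => ((x₀, t) : ℝ × ℝ)) (by fun_prop) fun t _ => ⟨hx₀, mem_univ _⟩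
  refine (intervalIntegral.hasDerivAt_integral_of_dominated_loc_of_deriv_le
    (bound := fun _ => C) (Metric.closedBall_mem_nhds x₀ hε) ?_
    ((hf x₀ hx₀).intervalIntegrable _ _) hcont.aestronglyMeasurable ?_ (by simp) ?_).2
  · filter_upwards [hU.mem_nhds hx₀] with x hx using (hf x hx).aestronglyMeasurable
  · exact .of_forall fun t ht x hx => hC (x, t) ⟨hx, uIoc_subset_uIcc ht⟩
  · exact .of_forall fun t _ x hx => hd x (hball hx) t

/-- The Abelian integral `∫ sin² t √(1 + s cos t) dt`, equal to `2 Ī₂ (s² - 1) / s²`. -/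
noncomputable def sinSqSqrt (s : ℝ) : ℝ := ∫ t in (0 : ℝ)..π, sin t ^ 2 * √(1 + s * cos t)

/-- The derivative of `sinSqSqrt`. -/
noncomputable def sinSqSqrtDeriv (s : ℝ) : ℝ :=
  ∫ t in (0 : ℝ)..π, sin t ^ 2 * cos t / (2 * √(1 + s * cos t))

/-- The second derivative of `sinSqSqrt`. -/
noncomputable def sinSqSqrtDeriv₂ (s : ℝ) : ℝ :=
  ∫ t in (0 : ℝ)..π, -(sin t ^ 2 * cos t ^ 2 / (4 * √(1 + s * cos t) ^ 3))

theorem one_add_mul_cos_pos {s : ℝ} (hs : s ∈ Ioo (-1 : ℝ) 1) (t : ℝ) : 0 < 1 + s * cos t := by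
  have h : |s * cos t| < 1 := by
    rw [abs_mul]
    exact (mul_le_of_le_one_right (abs_nonneg s) (abs_cos_le_one t)).trans_lt (abs_lt.2 hs)
  linarith [(abs_lt.1 h).1]

theorem hasDerivAt_sqrt_one_add_mul_cos {s : ℝ} (hs : s ∈ Ioo (-1 : ℝ) 1) (t : ℝ) :
    HasDerivAt (fun y => √(1 + y * cos t)) (cos t / (2 * √(1 + s * cos t))) s := by
  have h := (((hasDerivAt_id s).mul_const (cos t)).const_add 1).sqrt
    (one_add_mul_cos_pos hs t).ne'
  simpa using h

theorem hasDerivAt_sinSqSqrt {s : ℝ} (hs : s ∈ Ioo (-1 : ℝ) 1) :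
    HasDerivAt sinSqSqrt (sinSqSqrtDeriv s) s := by
  refine hasDerivAt_intervalIntegral_of_continuousOn
    (f' := fun x t => sin t ^ 2 * cos t / (2 * √(1 + x * cos t)))
    isOpen_Ioo hs (fun x _ => by fun_prop) ?_ fun x hx t => ?_
  · refine ContinuousOn.div (by fun_prop) (by fun_prop) ?_
    rintro ⟨x, t⟩ ⟨hx, -⟩
    have := sqrt_pos.2 (one_add_mul_cos_pos hx t)
    positivity
  · exact ((hasDerivAt_sqrt_one_add_mul_cos hx t).const_mul (sin t ^ 2)).congr_deriv (by ring)

theorem hasDerivAt_sinSqSqrtDeriv {s : ℝ} (hs : s ∈ Ioo (-1 : ℝ) 1) :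
    HasDerivAt sinSqSqrtDeriv (sinSqSqrtDeriv₂ s) s := by
  refine hasDerivAt_intervalIntegral_of_continuousOn
    (f' := fun x t => -(sin t ^ 2 * cos t ^ 2 / (4 * √(1 + x * cos t) ^ 3)))
    isOpen_Ioo hs (fun x hx => ?_) ?_ fun x hx t => ?_
  · refine Continuous.div (by fun_prop) (by fun_prop) fun t => ?_
    have := sqrt_pos.2 (one_add_mul_cos_pos hx t)
    positivity
  · refine (ContinuousOn.div (by fun_prop) (by fun_prop) ?_).neg
    rintro ⟨x, t⟩ ⟨hx, -⟩
    have := sqrt_pos.2 (one_add_mul_cos_pos hx t)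
    positivity
  · have h0 := sqrt_pos.2 (one_add_mul_cos_pos hx t)
    refine ((hasDerivAt_const x (sin t ^ 2 * cos t)).fun_div
      ((hasDerivAt_sqrt_one_add_mul_cos hx t).const_mul 2) (by positivity)).congr_deriv ?_
    field_simp
    ring

/-- The Picard-Fuchs equation of `sinSqSqrt`. -/
theorem sinSqSqrt_picardFuchs {s : ℝ} (hs : s ∈ Ioo (-1 : ℝ) 1) :
    s * (1 - s ^ 2) * sinSqSqrtDeriv₂ s + (3 - s ^ 2) * sinSqSqrtDeriv s
      + s / 4 * sinSqSqrt s = 0 := by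
  have hpos := fun t => sqrt_pos.2 (one_add_mul_cos_pos hs t)
  have c0 : Continuous fun t => sin t ^ 2 * √(1 + s * cos t) := by fun_prop
  have c1 : Continuous fun t => sin t ^ 2 * cos t / (2 * √(1 + s * cos t)) :=
    Continuous.div (by fun_prop) (by fun_prop) fun t => (mul_pos two_pos (hpos t)).ne'
  have c2 : Continuous fun t => -(sin t ^ 2 * cos t ^ 2 / (4 * √(1 + s * cos t) ^ 3)) :=
    (Continuous.div (by fun_prop) (by fun_prop) fun t => by have := hpos t; positivity).neg
  have i0 := c0.intervalIntegrable (μ := volume) 0 π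
  have i1 := c1.intervalIntegrable (μ := volume) 0 π
  have i2 := c2.intervalIntegrable (μ := volume) 0 π
  unfold sinSqSqrt sinSqSqrtDeriv sinSqSqrtDeriv₂
  rw [← intervalIntegral.integral_const_mul, ← intervalIntegral.integral_const_mul,
    ← intervalIntegral.integral_const_mul,
    ← intervalIntegral.integral_add (i2.const_mul _) (i1.const_mul _),
    ← intervalIntegral.integral_add ((i2.const_mul _).add (i1.const_mul _)) (i0.const_mul _)]
  rw [intervalIntegral.integral_eq_sub_of_hasDerivAt
    (f := fun t => sin t ^ 3 / (2 * √(1 + s * cos t)))]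
  · simp
  · intro t _
    have h0 := hpos t
    have hsq : √(1 + s * cos t) ^ 2 = 1 + s * cos t := sq_sqrt (one_add_mul_cos_pos hs t).le
    have hw : HasDerivAt (fun t => √(1 + s * cos t)) (-(s * sin t) / (2 * √(1 + s * cos t))) t := by
      have h := (((hasDerivAt_cos t).const_mul s).const_add 1).sqrt (one_add_mul_cos_pos hs t).ne'
      convert h using 1
      ring
    refine (((hasDerivAt_sin t).fun_pow 3).fun_div (hw.const_mul 2)
      (by positivity)).congr_deriv ?_
    have hsin : sin t ^ 2 = 1 - cos t ^ 2 := sin_sq t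
    generalize √(1 + s * cos t) = w at h0 hsq ⊢
    generalize cos t = c at hsq hsin ⊢
    generalize sin t = z at hsin ⊢
    trans z ^ 2 * (-s * (1 - s ^ 2) * c ^ 2 + 2 * (3 - s ^ 2) * c * w ^ 2 + s * (w ^ 2) ^ 2)
      / (4 * w ^ 3)
    · trans z ^ 2 * (6 * c * w ^ 2 + s * z ^ 2) / (4 * w ^ 3)
      · push_cast
        field_simp
        ring
      · rw [hsin, hsq]
        ring
    · field_simp
      ring
  · exact (((i2.const_mul _).add (i1.const_mul _)).add (i0.const_mul _))

theorem sinSqSqrt_pos {s : ℝ} (hs : s ∈ Ioo (-1 : ℝ) 1) : 0 < sinSqSqrt s := by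
  refine intervalIntegral.intervalIntegral_pos_of_pos_on
    (Continuous.intervalIntegrable (by fun_prop) _ _) (fun t ht => ?_) pi_pos
  have h1 := sqrt_pos.2 (one_add_mul_cos_pos hs t)
  have h2 := sin_pos_of_mem_Ioo ht
  positivity

theorem sinSqSqrt_zero : sinSqSqrt 0 = π / 2 := by
  simp [sinSqSqrt, integral_sin_sq]

theorem sinSqSqrtDeriv_zero : sinSqSqrtDeriv 0 = 0 := by
  have h := sinSqSqrt_picardFuchs (s := 0) (by norm_num)
  linarith

theorem sinSqSqrtDeriv₂_zero : sinSqSqrtDeriv₂ 0 = -π / 32 := by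
  have h := integral_sin_sq_mul_cos_sq (a := 0) (b := π)
  have h4 : sin (4 * π) = 0 := by exact_mod_cast sin_nat_mul_pi 4
  simp [sinSqSqrtDeriv₂, h, h4]
  ring

theorem Ibar_two_eq {s : ℝ} (hs : s ∈ Ioo (0 : ℝ) 1) :
    Ibar 2 (s ^ 2 - 1) = s ^ 2 / 2 * sinSqSqrt s := by
  have hs' : s ∈ Ioo (-1 : ℝ) 1 := ⟨by linarith [hs.1], hs.2⟩
  have hpos := fun t => sqrt_pos.2 (one_add_mul_cos_pos hs' t)
  have hsub := intervalIntegral.integral_comp_mul_deriv' (a := π) (b := 0)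
    (f := fun t => √(1 + s * cos t)) (f' := fun t => -(s * sin t) / (2 * √(1 + s * cos t)))
    (g := fun u => u ^ 2 * √(s ^ 2 - 1 + 2 * u ^ 2 - u ^ 4)) (fun t _ => by
      have h := (((hasDerivAt_cos t).const_mul s).const_add 1).sqrt (one_add_mul_cos_pos hs' t).ne'
      convert h using 1
      ring)
    (Continuous.continuousOn <| Continuous.div (by fun_prop) (by fun_prop)
      fun t => (mul_pos two_pos (hpos t)).ne') (Continuous.continuousOn (by fun_prop))
  have hrt : √(1 + (s ^ 2 - 1)) = s := by
    rw [add_sub_cancel, sqrt_sq hs.1.le]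
  simp only [cos_pi, cos_zero, mul_neg, mul_one, ← sub_eq_add_neg] at hsub
  rw [Ibar, hrt, ← hsub, intervalIntegral.integral_symm, sinSqSqrt,
    ← intervalIntegral.integral_const_mul, ← intervalIntegral.integral_neg]
  refine intervalIntegral.integral_congr fun t ht => ?_
  rw [uIcc_of_le pi_pos.le] at ht
  have hsq : √(1 + s * cos t) ^ 2 = 1 + s * cos t := sq_sqrt (one_add_mul_cos_pos hs' t).le
  have hrad : s ^ 2 - 1 + 2 * √(1 + s * cos t) ^ 2 - √(1 + s * cos t) ^ 4 = (s * sin t) ^ 2 := by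
    rw [show √(1 + s * cos t) ^ 4 = (√(1 + s * cos t) ^ 2) ^ 2 by ring, hsq, mul_pow, sin_sq]
    ring
  have h0 := hpos t
  simp only [Function.comp]
  rw [hrad, sqrt_sq (mul_nonneg hs.1.le (sin_nonneg_of_mem_Icc ht))]
  field_simp

/-- `sinSqSqrt` as a function of `r = √(1 - s²)`. -/
noncomputable def circG (r : ℝ) : ℝ := sinSqSqrt √(1 - r ^ 2)

/-- The derivative of `sinSqSqrt` with respect to `s²`, as a function of `r = √(1 - s²)`. -/
noncomputable def circN (r : ℝ) : ℝ := sinSqSqrtDeriv √(1 - r ^ 2) / (2 * √(1 - r ^ 2))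

theorem one_sub_sq_pos {r : ℝ} (hr : r ∈ Ioo (0 : ℝ) 1) : 0 < 1 - r ^ 2 := by
  nlinarith [hr.1, hr.2]

theorem sqrt_one_sub_sq_mem {r : ℝ} (hr : r ∈ Ioo (0 : ℝ) 1) : √(1 - r ^ 2) ∈ Ioo (0 : ℝ) 1 :=
  ⟨sqrt_pos.2 (one_sub_sq_pos hr), by
    rw [sqrt_lt' one_pos]
    nlinarith [hr.1]⟩

theorem sqrt_one_sub_sq_mem' {r : ℝ} (hr : r ∈ Ioo (0 : ℝ) 1) :
    √(1 - r ^ 2) ∈ Ioo (-1 : ℝ) 1 :=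
  ⟨by linarith [(sqrt_one_sub_sq_mem hr).1], (sqrt_one_sub_sq_mem hr).2⟩

theorem hasDerivAt_sqrt_one_sub_sq {r : ℝ} (hr : r ∈ Ioo (0 : ℝ) 1) :
    HasDerivAt (fun r => √(1 - r ^ 2)) (-r / √(1 - r ^ 2)) r := by
  refine (((hasDerivAt_id r).fun_pow 2).const_sub 1).sqrt (one_sub_sq_pos hr).ne' |>.congr_deriv ?_
  have := (sqrt_one_sub_sq_mem hr).1
  simp only [id]
  field_simp
  simp

theorem circG_pos {r : ℝ} (hr : r ∈ Ioo (0 : ℝ) 1) : 0 < circG r :=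
  sinSqSqrt_pos (sqrt_one_sub_sq_mem' hr)

theorem hasDerivAt_circG {r : ℝ} (hr : r ∈ Ioo (0 : ℝ) 1) :
    HasDerivAt circG (-2 * r * circN r) r := by
  refine ((hasDerivAt_sinSqSqrt (sqrt_one_sub_sq_mem' hr)).comp r
    (hasDerivAt_sqrt_one_sub_sq hr)).congr_deriv ?_
  have := (sqrt_one_sub_sq_mem hr).1
  unfold circN
  field_simp

theorem hasDerivAt_circN {r : ℝ} (hr : r ∈ Ioo (0 : ℝ) 1) :
    HasDerivAt circN (((2 + 2 * r ^ 2) * circN r + circG r / 8) / (r * (1 - r ^ 2))) r := by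
  have hs := (sqrt_one_sub_sq_mem hr).1
  have hr0 := hr.1
  have hx := one_sub_sq_pos hr
  refine (((hasDerivAt_sinSqSqrtDeriv (sqrt_one_sub_sq_mem' hr)).comp r
    (hasDerivAt_sqrt_one_sub_sq hr)).fun_div ((hasDerivAt_sqrt_one_sub_sq hr).const_mul 2)
    (by positivity)).congr_deriv ?_
  have hpf := sinSqSqrt_picardFuchs (sqrt_one_sub_sq_mem' hr)
  have hsq : √(1 - r ^ 2) ^ 2 = 1 - r ^ 2 := sq_sqrt hx.le
  simp only [circG, circN, Function.comp]
  generalize √(1 - r ^ 2) = s at *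
  generalize sinSqSqrtDeriv₂ s = C at *
  have hC : C = -((3 - s ^ 2) * sinSqSqrtDeriv s + s / 4 * sinSqSqrt s) / (s * r ^ 2) := by
    rw [eq_div_iff (by positivity)]
    linear_combination hpf + s * C * hsq
  rw [hC, ← hsq, show s ^ 2 = 1 - r ^ 2 from hsq]
  have hr2 : r ^ 2 = 1 - s ^ 2 := by linarith
  rw [← hsq]
  field_simp
  rw [hr2]
  ring

theorem tendsto_sqrt_one_sub_sq : Tendsto (fun r : ℝ => √(1 - r ^ 2)) (𝓝[<] 1) (𝓝[≠] 0) := by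
  refine tendsto_nhdsWithin_iff.2 ⟨?_, ?_⟩
  · have : Continuous fun r : ℝ => √(1 - r ^ 2) := by fun_prop
    simpa using (this.tendsto 1).mono_left nhdsWithin_le_nhds
  · filter_upwards [Ioo_mem_nhdsLT (zero_lt_one' ℝ)] with r hr
    exact (sqrt_one_sub_sq_mem hr).1.ne'

theorem tendsto_circG : Tendsto circG (𝓝[<] 1) (𝓝 (π / 2)) := by
  have h := (hasDerivAt_sinSqSqrt (s := 0) (by norm_num)).continuousAt.tendsto
  rw [sinSqSqrt_zero] at h
  exact (h.mono_left nhdsWithin_le_nhds).comp tendsto_sqrt_one_sub_sq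

theorem tendsto_circN : Tendsto circN (𝓝[<] 1) (𝓝 (-π / 64)) := by
  have h := (hasDerivAt_iff_tendsto_slope.1
    (hasDerivAt_sinSqSqrtDeriv (s := 0) (by norm_num))).comp tendsto_sqrt_one_sub_sq
  rw [sinSqSqrtDeriv₂_zero] at h
  convert h.div_const 2 using 2
  · simp only [Function.comp, circN, slope_def_field, sinSqSqrtDeriv_zero, sub_zero]
    rw [div_div, mul_comm]
  · ring

/-- Up to a positive factor, the derivative of `ratioFun`. -/
noncomputable def ratioNum (r : ℝ) : ℝ :=
  (240 + 282 * r + 204 * r ^ 2 + 60 * r ^ 3 - 84 * r ^ 4 + 18 * r ^ 5) * circN r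
    + (15 + 9 / 2 * r - 6 * r ^ 2 + 9 / 2 * r ^ 3) * circG r

/-- The derivative of `ratioNum`. -/
noncomputable def ratioNumDeriv (r : ℝ) : ℝ :=
  (282 + 408 * r + 180 * r ^ 2 - 336 * r ^ 3 + 90 * r ^ 4) * circN r
    + (240 + 282 * r + 204 * r ^ 2 + 60 * r ^ 3 - 84 * r ^ 4 + 18 * r ^ 5)
      * (((2 + 2 * r ^ 2) * circN r + circG r / 8) / (r * (1 - r ^ 2)))
    + ((9 / 2 - 12 * r + 27 / 2 * r ^ 2) * circG r
      + (15 + 9 / 2 * r - 6 * r ^ 2 + 9 / 2 * r ^ 3) * (-2 * r * circN r))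

theorem hasDerivAt_ratioNum {r : ℝ} (hr : r ∈ Ioo (0 : ℝ) 1) :
    HasDerivAt ratioNum (ratioNumDeriv r) r := by
  have hA : HasDerivAt
      (fun r : ℝ => 240 + 282 * r + 204 * r ^ 2 + 60 * r ^ 3 - 84 * r ^ 4 + 18 * r ^ 5)
      (282 + 408 * r + 180 * r ^ 2 - 336 * r ^ 3 + 90 * r ^ 4) r := by
    have := ((((((hasDerivAt_id r).const_mul 282).const_add 240).add
      (((hasDerivAt_id r).fun_pow 2).const_mul 204)).add
      (((hasDerivAt_id r).fun_pow 3).const_mul 60)).sub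
      (((hasDerivAt_id r).fun_pow 4).const_mul 84)).add
      (((hasDerivAt_id r).fun_pow 5).const_mul 18)
    refine this.congr_deriv ?_
    simp only [id]
    push_cast
    ring
  have hB : HasDerivAt (fun r : ℝ => 15 + 9 / 2 * r - 6 * r ^ 2 + 9 / 2 * r ^ 3)
      (9 / 2 - 12 * r + 27 / 2 * r ^ 2) r := by
    have := ((((hasDerivAt_id r).const_mul (9 / 2)).const_add 15).sub
      (((hasDerivAt_id r).fun_pow 2).const_mul 6)).add
      (((hasDerivAt_id r).fun_pow 3).const_mul (9 / 2))
    refine this.congr_deriv ?_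
    simp only [id]
    push_cast
    ring
  exact (hA.fun_mul (hasDerivAt_circN hr)).add (hB.fun_mul (hasDerivAt_circG hr))

theorem ratioNumDeriv_pos_of_eq_zero {r : ℝ} (hr : r ∈ Ioo (0 : ℝ) 1) (h : ratioNum r = 0) :
    0 < ratioNumDeriv r := by
  obtain ⟨h0, h1⟩ := hr
  have hx := one_sub_sq_pos ⟨h0, h1⟩
  have hG := circG_pos ⟨h0, h1⟩
  have hA : 0 < 240 + 282 * r + 204 * r ^ 2 + 60 * r ^ 3 - 84 * r ^ 4 + 18 * r ^ 5 := by
    have : r ^ 4 ≤ 1 := pow_le_one₀ h0.le h1.le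
    have : 0 < 282 * r + 204 * r ^ 2 + 60 * r ^ 3 + 18 * r ^ 5 := by positivity
    linarith
  have hZ : 0 < 3150 * r + 1305 / 2 * r ^ 2 + 6300 * r ^ 3 + 31545 / 2 * r ^ 4 - 2070 * r ^ 5
      - 20565 / 2 * r ^ 6 - 900 * r ^ 7 + 675 / 2 * r ^ 8 := by
    have h5 : r ^ 5 ≤ r ^ 4 := pow_le_pow_of_le_one h0.le h1.le (by norm_num)
    have h6 : r ^ 6 ≤ r ^ 4 := pow_le_pow_of_le_one h0.le h1.le (by norm_num)
    have h7 : r ^ 7 ≤ r ^ 4 := pow_le_pow_of_le_one h0.le h1.le (by norm_num)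
    have : 0 < 3150 * r + 1305 / 2 * r ^ 2 + 6300 * r ^ 3 + 675 / 2 * r ^ 8 := by positivity
    have : 0 < r ^ 4 := by positivity
    linarith
  have key : r * (1 - r ^ 2)
      * (240 + 282 * r + 204 * r ^ 2 + 60 * r ^ 3 - 84 * r ^ 4 + 18 * r ^ 5) * ratioNumDeriv r
      = (3150 * r + 1305 / 2 * r ^ 2 + 6300 * r ^ 3 + 31545 / 2 * r ^ 4 - 2070 * r ^ 5
      - 20565 / 2 * r ^ 6 - 900 * r ^ 7 + 675 / 2 * r ^ 8) * circG r := by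
    have hmul : r * (1 - r ^ 2) * ratioNumDeriv r =
        r * (1 - r ^ 2) * ((282 + 408 * r + 180 * r ^ 2 - 336 * r ^ 3 + 90 * r ^ 4) * circN r
        + ((9 / 2 - 12 * r + 27 / 2 * r ^ 2) * circG r
          + (15 + 9 / 2 * r - 6 * r ^ 2 + 9 / 2 * r ^ 3) * (-2 * r * circN r)))
        + (240 + 282 * r + 204 * r ^ 2 + 60 * r ^ 3 - 84 * r ^ 4 + 18 * r ^ 5)
          * ((2 + 2 * r ^ 2) * circN r + circG r / 8) := by
      unfold ratioNumDeriv
      field_simp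
      ring
    unfold ratioNum at h
    linear_combination
      (240 + 282 * r + 204 * r ^ 2 + 60 * r ^ 3 - 84 * r ^ 4 + 18 * r ^ 5) * hmul
      + (r * (1 - r ^ 2) * ((282 + 408 * r + 180 * r ^ 2 - 336 * r ^ 3 + 90 * r ^ 4)
          + (15 + 9 / 2 * r - 6 * r ^ 2 + 9 / 2 * r ^ 3) * (-2 * r))
        + (240 + 282 * r + 204 * r ^ 2 + 60 * r ^ 3 - 84 * r ^ 4 + 18 * r ^ 5)
          * (2 + 2 * r ^ 2)) * h
  refine pos_of_mul_pos_right (a := r * (1 - r ^ 2)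
      * (240 + 282 * r + 204 * r ^ 2 + 60 * r ^ 3 - 84 * r ^ 4 + 18 * r ^ 5)) ?_ (by positivity)
  rw [key]
  positivity

theorem ratioNum_neg {r : ℝ} (hr : r ∈ Ioo (0 : ℝ) 1) : ratioNum r < 0 := by
  by_contra! hnn
  have hev : ∀ᶠ x in 𝓝[<] (1 : ℝ), ratioNum x < 0 := by
    have hcA : Tendsto
        (fun r : ℝ => 240 + 282 * r + 204 * r ^ 2 + 60 * r ^ 3 - 84 * r ^ 4 + 18 * r ^ 5)
        (𝓝[<] 1) (𝓝 720) := by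
      refine (Continuous.tendsto' (by fun_prop) 1 720 (by norm_num)).mono_left nhdsWithin_le_nhds
    have hcB : Tendsto (fun r : ℝ => 15 + 9 / 2 * r - 6 * r ^ 2 + 9 / 2 * r ^ 3)
        (𝓝[<] 1) (𝓝 18) := by
      refine (Continuous.tendsto' (by fun_prop) 1 18 (by norm_num)).mono_left nhdsWithin_le_nhds
    have hlim := (hcA.mul tendsto_circN).add (hcB.mul tendsto_circG)
    refine hlim.eventually_lt_const ?_
    linarith [pi_pos]
  obtain ⟨b, hb, hrb, hb1⟩ := (hev.and (Ioo_mem_nhdsLT hr.2)).exists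
  have hmem : ∀ x ∈ Icc r b, x ∈ Ioo (0 : ℝ) 1 := fun x hx =>
    ⟨hr.1.trans_le hx.1, hx.2.trans_lt hb1⟩
  have := image_le_of_deriv_right_lt_deriv_boundary (f := fun x => -ratioNum x)
    (f' := fun x => -ratioNumDeriv x) (B := fun _ => 0) (B' := fun _ => 0) (a := r) (b := b)
    (fun x hx => (hasDerivAt_ratioNum (hmem x hx)).neg.continuousAt.continuousWithinAt)
    (fun x hx => (hasDerivAt_ratioNum (hmem x (Ico_subset_Icc_self hx))).neg.hasDerivWithinAt)
    (by simpa using hnn) (fun x => hasDerivAt_const x 0)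
    (fun x hx h => by
      have := ratioNumDeriv_pos_of_eq_zero (hmem x (Ico_subset_Icc_self hx)) (neg_eq_zero.1 h)
      linarith) (right_mem_Icc.2 hrb.le)
  linarith

/-- The function `M` with `d(s · sinSqSqrt s)/ds = M(r)`. -/
noncomputable def circM (r : ℝ) : ℝ := circG r + 2 * (1 - r ^ 2) * circN r

/-- The derivative of `circM`. -/
noncomputable def circMDeriv (r : ℝ) : ℝ := ((4 - 2 * r ^ 2) * circN r + circG r / 4) / r

theorem hasDerivAt_circM {r : ℝ} (hr : r ∈ Ioo (0 : ℝ) 1) :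
    HasDerivAt circM (circMDeriv r) r := by
  have hx := one_sub_sq_pos hr
  have h0 := hr.1
  refine ((hasDerivAt_circG hr).add (((((hasDerivAt_id r).fun_pow 2).const_sub 1).const_mul
    2).fun_mul (hasDerivAt_circN hr))).congr_deriv ?_
  simp only [id, circMDeriv]
  push_cast
  field_simp
  ring

/-- The second derivative of `circM`. -/
noncomputable def circMDeriv₂ (r : ℝ) : ℝ :=
  ((8 + 11 * r ^ 2 - 3 * r ^ 4) * circN r + circG r / 2) / (2 * r ^ 2 * (1 - r ^ 2))

theorem hasDerivAt_circMDeriv {r : ℝ} (hr : r ∈ Ioo (0 : ℝ) 1) :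
    HasDerivAt circMDeriv (circMDeriv₂ r) r := by
  have hx := one_sub_sq_pos hr
  have h0 := hr.1
  refine (((((((hasDerivAt_id r).fun_pow 2).const_mul 2).const_sub 4).fun_mul
    (hasDerivAt_circN hr)).fun_add ((hasDerivAt_circG hr).div_const 4)).fun_div
    (hasDerivAt_id r) h0.ne').congr_deriv ?_
  simp only [id, circMDeriv₂]
  push_cast
  field_simp
  ring

/-- The quotient of the second derivatives of `P * circM` and `P`, for `P r = (1 + r) / √(1 - r)`. -/
noncomputable def ratioFun (r : ℝ) : ℝ :=
  circM r + 4 * (1 - r) / (7 - r) * ((3 - r) * circMDeriv r + (1 - r ^ 2) * circMDeriv₂ r)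

theorem hasDerivAt_ratioFun {r : ℝ} (hr : r ∈ Ioo (0 : ℝ) 1) :
    HasDerivAt ratioFun (ratioNum r / (r ^ 2 * (1 + r) * (7 - r) ^ 2)) r := by
  have hx := one_sub_sq_pos hr
  have h0 := hr.1
  have h7 : 0 < 7 - r := by linarith [hr.2]
  have hq : HasDerivAt (fun r : ℝ => 8 + 24 * r + 3 * r ^ 2 - 12 * r ^ 3 + r ^ 4)
      (24 + 6 * r - 36 * r ^ 2 + 4 * r ^ 3) r := by
    have := (((((hasDerivAt_id r).const_mul 24).const_add 8).add
      (((hasDerivAt_id r).fun_pow 2).const_mul 3)).sub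
      (((hasDerivAt_id r).fun_pow 3).const_mul 12)).add ((hasDerivAt_id r).fun_pow 4)
    refine this.congr_deriv ?_
    simp only [id]
    push_cast
    ring
  have hg : HasDerivAt (fun r : ℝ => (1 + 3 * r - r ^ 2) / 2) ((3 - 2 * r) / 2) r := by
    have := ((((hasDerivAt_id r).const_mul 3).const_add 1).sub
      ((hasDerivAt_id r).fun_pow 2)).div_const 2
    refine this.congr_deriv ?_
    simp only [id]
    push_cast
    ring
  have hl : HasDerivAt (fun r : ℝ => 2 * (1 - r) / ((7 - r) * r ^ 2))
      ((-2 * ((7 - r) * r ^ 2) - 2 * (1 - r) * (14 * r - 3 * r ^ 2)) / ((7 - r) * r ^ 2) ^ 2) r := by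
    refine ((((hasDerivAt_id r).const_sub 1).const_mul 2).fun_div
      (((hasDerivAt_id r).const_sub 7).fun_mul ((hasDerivAt_id r).fun_pow 2))
      (by simp only [id]; positivity)).congr_deriv ?_
    simp only [id]
    push_cast
    ring
  have hmain := (hasDerivAt_circM hr).fun_add (hl.fun_mul
    ((hq.fun_mul (hasDerivAt_circN hr)).fun_add (hg.fun_mul (hasDerivAt_circG hr))))
  refine (hmain.congr_of_eventuallyEq ?_).congr_deriv ?_
  · filter_upwards [isOpen_Ioo.mem_nhds hr] with y hy
    have := hy.1
    have := one_sub_sq_pos hy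
    have : 0 < 7 - y := by linarith [hy.2]
    unfold ratioFun circMDeriv circMDeriv₂
    field_simp
    ring
  · have : 0 < 1 + r := by linarith
    have : 0 < 1 - r := by linarith [hr.2]
    rw [show 1 - r ^ 2 = (1 - r) * (1 + r) by ring]
    unfold ratioNum circMDeriv
    field_simp
    ring

theorem hasDerivAt_sqrt_one_add {r : ℝ} (hr : r ∈ Ioo (0 : ℝ) 1) :
    HasDerivAt (fun r => √(1 + r)) (1 / (2 * √(1 + r))) r := by
  simpa using ((hasDerivAt_id r).const_add 1).sqrt (by simp only [id]; linarith [hr.1])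

theorem hasDerivAt_sqrt_one_sub {r : ℝ} (hr : r ∈ Ioo (0 : ℝ) 1) :
    HasDerivAt (fun r => √(1 - r)) (-1 / (2 * √(1 - r))) r := by
  simpa using ((hasDerivAt_id r).const_sub 1).sqrt (by simp only [id]; linarith [hr.2])

section reduction

variable (c1 c2 c3 c4 d : ℝ)

/-- The function of the theorem divided by `√(1 + h)`, in terms of `r = √(-h)`. -/
noncomputable def redZero (r : ℝ) : ℝ :=
  c1 + c2 * ((2 + r) / √(1 + r)) - c3 * (r ^ 2 / √(1 + r)) + c4 * (√(1 + r) * √(1 - r))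
    + d * (√(1 + r) * √(1 - r) * circG r)

/-- `(1 + r) ^ (3 / 2) / r` times the derivative of `redZero`. -/
noncomputable def redOne (r : ℝ) : ℝ :=
  c2 / 2 - c3 * (4 + 3 * r) / 2 - (1 + r) / √(1 - r) * (c4 + d * circM r)

/-- The derivative of `redOne`. -/
noncomputable def redTwo (r : ℝ) : ℝ :=
  -3 * c3 / 2 - ((3 - r) / 2 * (c4 + d * circM r) + (1 - r ^ 2) * (d * circMDeriv r))
    / √(1 - r) ^ 3

theorem hasDerivAt_redZero {r : ℝ} (hr : r ∈ Ioo (0 : ℝ) 1) :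
    HasDerivAt (redZero c1 c2 c3 c4 d) (r / √(1 + r) ^ 3 * redOne c2 c3 c4 d r) r := by
  have hw : 0 < √(1 + r) := sqrt_pos.2 (by linarith [hr.1])
  have hv : 0 < √(1 - r) := sqrt_pos.2 (by linarith [hr.2])
  have hw2 : √(1 + r) ^ 2 = 1 + r := sq_sqrt (by linarith [hr.1])
  have hv2 : √(1 - r) ^ 2 = 1 - r := sq_sqrt (by linarith [hr.2])
  have dw := hasDerivAt_sqrt_one_add hr
  have dv := hasDerivAt_sqrt_one_sub hr
  have dwv := dw.fun_mul dv
  refine (((((((hasDerivAt_id r).const_add 2).fun_div dw hw.ne').const_mul c2).const_add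
    c1).fun_sub ((((hasDerivAt_id r).fun_pow 2).fun_div dw hw.ne').const_mul c3)).fun_add
    (dwv.const_mul c4)).fun_add ((dwv.fun_mul (hasDerivAt_circG hr)).const_mul d)
    |>.congr_deriv ?_
  simp only [id, redOne, circM]
  push_cast
  generalize circG r = G
  generalize circN r = n
  generalize √(1 + r) = w at *
  generalize √(1 - r) = v at *
  obtain rfl : r = w ^ 2 - 1 := by linarith
  have hv2' : v ^ 2 = 2 - w ^ 2 := by linarith
  have e1 : 1 / (2 * w) * v + w * (-1 / (2 * v)) = -(w ^ 2 - 1) / (v * w) := by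
    field_simp
    rw [hv2']
    ring
  have e2 : w * v = w * (2 - w ^ 2) / v := by
    rw [← hv2']
    field_simp
  rw [e1, e2]
  field_simp
  ring

theorem hasDerivAt_redOne {r : ℝ} (hr : r ∈ Ioo (0 : ℝ) 1) :
    HasDerivAt (redOne c2 c3 c4 d) (redTwo c3 c4 d r) r := by
  have hv : 0 < √(1 - r) := sqrt_pos.2 (by linarith [hr.2])
  have hv2 : √(1 - r) ^ 2 = 1 - r := sq_sqrt (by linarith [hr.2])
  have dv := hasDerivAt_sqrt_one_sub hr
  refine (((((((hasDerivAt_id r).const_mul 3).const_add 4).const_mul c3).div_const 2).const_sub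
    (c2 / 2)).fun_sub ((((hasDerivAt_id r).const_add 1).fun_div dv hv.ne').fun_mul
    (((hasDerivAt_circM hr).const_mul d).const_add c4))).congr_deriv ?_
  simp only [id, redTwo]
  generalize circM r = M
  generalize circMDeriv r = M'
  generalize √(1 - r) = v at *
  obtain rfl : r = 1 - v ^ 2 := by linarith
  field_simp
  ring

theorem hasDerivAt_redTwo {r : ℝ} (hr : r ∈ Ioo (0 : ℝ) 1) :
    HasDerivAt (redTwo c3 c4 d)
      (-((7 - r) / (4 * √(1 - r) ^ 5)) * (c4 + d * ratioFun r)) r := by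
  have hv : 0 < √(1 - r) := sqrt_pos.2 (by linarith [hr.2])
  have hv2 : √(1 - r) ^ 2 = 1 - r := sq_sqrt (by linarith [hr.2])
  have h7 : 0 < 7 - r := by linarith [hr.2]
  have dv := hasDerivAt_sqrt_one_sub hr
  refine ((((((hasDerivAt_id r).const_sub 3).div_const 2).fun_mul
    (((hasDerivAt_circM hr).const_mul d).const_add c4)).fun_add
    ((((hasDerivAt_id r).fun_pow 2).const_sub 1).fun_mul
    ((hasDerivAt_circMDeriv hr).const_mul d))).fun_div (dv.fun_pow 3)
    (by positivity)).const_sub (-3 * c3 / 2) |>.congr_deriv ?_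
  simp only [id, ratioFun]
  push_cast
  generalize circM r = M
  generalize circMDeriv r = M'
  generalize circMDeriv₂ r = M''
  generalize √(1 - r) = v at *
  obtain rfl : r = 1 - v ^ 2 := by linarith
  field_simp
  ring

/-- The theorem of Rolle for several zeros. -/
theorem exists_strictMono_zeros_deriv {f f' : ℝ → ℝ} {a b : ℝ}
    (hd : ∀ r ∈ Ioo a b, HasDerivAt f (f' r) r) {n : ℕ} {x : Fin (n + 1) → ℝ}
    (hx : StrictMono x) (hmem : ∀ i, x i ∈ Ioo a b) (hf : ∀ i, f (x i) = 0) :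
    ∃ y : Fin n → ℝ, StrictMono y ∧ (∀ i, y i ∈ Ioo a b) ∧ ∀ i, f' (y i) = 0 := by
  have hsub : ∀ i : Fin n, Icc (x i.castSucc) (x i.succ) ⊆ Ioo a b := fun i t ht =>
    ⟨(hmem _).1.trans_le ht.1, ht.2.trans_lt (hmem _).2⟩
  have h : ∀ i : Fin n, ∃ c ∈ Ioo (x i.castSucc) (x i.succ), f' c = 0 := fun i =>
    exists_hasDerivAt_eq_zero (hx i.castSucc_lt_succ)
      (fun t ht => (hd t (hsub i ht)).continuousAt.continuousWithinAt)
      ((hf _).trans (hf _).symm) fun t ht => hd t (hsub i (Ioo_subset_Icc_self ht))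
  choose y hy hy0 using h
  refine ⟨y, fun i j hij => ?_, fun i => hsub i (Ioo_subset_Icc_self (hy i)), hy0⟩
  exact (hy i).2.trans_le ((hx.monotone (Fin.succ_le_castSucc_iff.2 hij)).trans (hy j).1.le)

theorem redZero_coeff_eq_zero {x : Fin 5 → ℝ} (hx : StrictMono x)
    (hmem : ∀ i, x i ∈ Ioo (0 : ℝ) 1) (h : ∀ i, redZero c1 c2 c3 c4 d (x i) = 0) :
    c1 = 0 ∧ c2 = 0 ∧ c3 = 0 ∧ c4 = 0 ∧ d = 0 := by
  obtain ⟨y, hy, hymem, hy0⟩ := exists_strictMono_zeros_deriv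
    (fun r => hasDerivAt_redZero c1 c2 c3 c4 d) hx hmem h
  have hy1 : ∀ i, redOne c2 c3 c4 d (y i) = 0 := fun i => by
    have h0 := (hymem i).1
    have : 0 < √(1 + y i) := sqrt_pos.2 (by linarith)
    exact (mul_eq_zero.1 (hy0 i)).resolve_left (by positivity)
  obtain ⟨z, hz, hzmem, hz0⟩ := exists_strictMono_zeros_deriv
    (fun r => hasDerivAt_redOne c2 c3 c4 d) hy hymem hy1
  obtain ⟨u, hu, humem, hu0⟩ := exists_strictMono_zeros_deriv
    (fun r => hasDerivAt_redTwo c3 c4 d) hz hzmem hz0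
  have hu1 : ∀ i, c4 + d * ratioFun (u i) = 0 := fun i => by
    have : 0 < √(1 - u i) := sqrt_pos.2 (by linarith [(humem i).2])
    have : 0 < 7 - u i := by linarith [(humem i).2]
    exact (mul_eq_zero.1 (hu0 i)).resolve_left (neg_ne_zero.2 (by positivity))
  obtain ⟨q, -, hqmem, hq0⟩ := exists_strictMono_zeros_deriv
    (fun r hr => ((hasDerivAt_ratioFun hr).const_mul d).const_add c4) hu humem hu1
  have hd : d = 0 := by
    have h0 := (hqmem 0).1
    have : 0 < 7 - q 0 := by linarith [(hqmem 0).2]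
    exact (mul_eq_zero.1 (hq0 0)).resolve_right
      (div_ne_zero (ratioNum_neg (hqmem 0)).ne (by positivity))
  have hc4 : c4 = 0 := by simpa [hd] using hu1 0
  have hc3 : c3 = 0 := by simpa [redTwo, hd, hc4] using hz0 0
  have hc2 : c2 = 0 := by simpa [redOne, hd, hc4, hc3] using hy1 0
  have hc1 : c1 = 0 := by simpa [redZero, hd, hc4, hc3, hc2] using h 0
  exact ⟨hc1, hc2, hc3, hc4, hd⟩

end reduction

theorem sqrt_mul_redZero (c1 c2 c3 c4 c5 : ℝ) {h : ℝ} (hh : h ∈ Ioo (-1 : ℝ) 0) :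
    √(1 + h) * redZero c1 c2 c3 c4 (c5 / 2) √(-h) =
      c1 * √(1 + h) + c2 * ((2 + √(-h)) * √(1 - √(-h))) + c3 * (h * √(1 - √(-h)))
        + c4 * (1 + h) + c5 * Ibar 2 h := by
  have hr : √(-h) ∈ Ioo (0 : ℝ) 1 := by
    refine ⟨sqrt_pos.2 (by linarith [hh.2]), ?_⟩
    rw [sqrt_lt' one_pos]
    linarith [hh.1]
  have hr2 : √(-h) ^ 2 = -h := sq_sqrt (by linarith [hh.2])
  generalize √(-h) = r at *
  obtain rfl : h = -r ^ 2 := by linarith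
  have hI : Ibar 2 (-r ^ 2) = (1 - r ^ 2) / 2 * circG r := by
    have := Ibar_two_eq (sqrt_one_sub_sq_mem hr)
    rw [sq_sqrt (one_sub_sq_pos hr).le] at this
    rw [circG, ← this]
    ring_nf
  have hfac : √(1 + -r ^ 2) = √(1 + r) * √(1 - r) := by
    rw [← sqrt_mul (by linarith [hr.1])]
    ring_nf
  have hw : 0 < √(1 + r) := sqrt_pos.2 (by linarith [hr.1])
  have hw2 : √(1 + r) ^ 2 = 1 + r := sq_sqrt (by linarith [hr.1])
  have hv2 : √(1 - r) ^ 2 = 1 - r := sq_sqrt (by linarith [hr.2])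
  have hs2 : (√(1 + r) * √(1 - r)) ^ 2 = 1 - r ^ 2 := by
    rw [mul_pow, hw2, hv2]
    ring
  rw [hI, hfac, redZero, show 1 + -r ^ 2 = 1 - r ^ 2 by ring, ← hs2]
  field_simp
  ring

/-- For reals `c₁,…,c₅` not all zero, the function
`h ↦ c₁ √(1+h) + c₂ (2+√(−h)) √(1−√(−h)) + c₃ h √(1−√(−h)) + c₄ (1+h) + c₅ Ī₂(h)`
has at most four zeros in `(−1,0)`. -/
theorem stmt18 (c1 c2 c3 c4 c5 : ℝ)
    (hne : ¬ (c1 = 0 ∧ c2 = 0 ∧ c3 = 0 ∧ c4 = 0 ∧ c5 = 0)) :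
    ∀ T : Finset ℝ,
      (∀ h ∈ T, h ∈ Set.Ioo (-1 : ℝ) 0 ∧
        c1 * Real.sqrt (1 + h)
          + c2 * ((2 + Real.sqrt (-h)) * Real.sqrt (1 - Real.sqrt (-h)))
          + c3 * (h * Real.sqrt (1 - Real.sqrt (-h)))
          + c4 * (1 + h) + c5 * Ibar 2 h = 0) →
      T.card ≤ 4 := by
  intro T hT
  by_contra! hcard
  obtain ⟨S, hST, hS⟩ := Finset.exists_subset_card_eq (show 5 ≤ T.card from hcard)
  have hinj : Set.InjOn (fun h => √(-h)) (S : Set ℝ) := fun a ha b hb hab => by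
    have ha0 := (hT a (hST ha)).1.2
    have hb0 := (hT b (hST hb)).1.2
    linarith [(sqrt_inj (by linarith) (by linarith)).1 hab]
  have hS' : (S.image fun h => √(-h)).card = 5 := (Finset.card_image_of_injOn hinj).trans hS
  have hzero : ∀ r ∈ S.image fun h => √(-h),
      r ∈ Ioo (0 : ℝ) 1 ∧ redZero c1 c2 c3 c4 (c5 / 2) r = 0 := by
    intro r hr
    obtain ⟨h, hh, rfl⟩ := Finset.mem_image.1 hr
    obtain ⟨hmem, h0⟩ := hT h (hST hh)
    rw [← sqrt_mul_redZero c1 c2 c3 c4 c5 hmem] at h0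
    refine ⟨⟨sqrt_pos.2 (by linarith [hmem.2]), ?_⟩, (mul_eq_zero.1 h0).resolve_left
      (sqrt_pos.2 (by linarith [hmem.1])).ne'⟩
    rw [sqrt_lt' one_pos]
    linarith [hmem.1]
  have hord := fun i => hzero _ (Finset.orderEmbOfFin_mem _ hS' i)
  obtain ⟨h1, h2, h3, h4, h5⟩ := redZero_coeff_eq_zero c1 c2 c3 c4 (c5 / 2)
    (Finset.orderEmbOfFin _ hS').strictMono (fun i => (hord i).1) fun i => (hord i).2
  exact hne ⟨h1, h2, h3, h4, by linarith⟩
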